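/- Let M ∈ ℝ^{m×m} be Hurwitz (hence invertible), let u : ℝ → ℝ^m be continuous with u(t) → u_∞ as t → ∞, and let x : ℝ → ℝ^m be differentiable with x′(t) = M·x(t) + u(t) for all t ≥ 0. Then x(t) → −M^{-1}·u_∞ as t → ∞. -/

import Mathlib

open Matrix Filter

/-- `M` is Hurwitz: every eigenvalue of `M` over `ℂ` has negative real part. -/
def IsHurwitz {m : ℕ} (M : Matrix (Fin m) (Fin m) ℝ) : Prop :=
  ∀ μ ∈ spectrum ℂ (M.map (algebraMap ℝ ℂ)), μ.re < 0

/-- A solution of `w' = μ • w + g` with `μ.re < 0` and `g → 0` tends to zero. -/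
lemma tendsto_zero_of_hasDerivAt_smul_add {E : Type*} [NormedAddCommGroup E] [NormedSpace ℂ E]
    {μ : ℂ} (hμ : μ.re < 0) {w g : ℝ → E}
    (hw : ∀ t, 0 ≤ t → HasDerivAt w (μ • w t + g t) t)
    (hg : Tendsto g atTop (nhds 0)) : Tendsto w atTop (nhds 0) := by
  rw [NormedAddGroup.tendsto_nhds_zero]
  intro ε hε
  set a : ℝ := -μ.re with ha
  have ha0 : 0 < a := by linarith
  obtain ⟨T₀, hT₀⟩ := eventually_atTop.1
    (NormedAddGroup.tendsto_nhds_zero.1 hg (a * (ε / 2)) (by positivity))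
  set T := max T₀ 0
  have norm_exp (t : ℝ) : ‖Complex.exp (-μ * t)‖ = Real.exp (a * t) := by
    rw [Complex.norm_exp]; simp [ha]
  set f : ℝ → E := fun t ↦ Complex.exp (-μ * t) • w t with hf
  have hf' (t : ℝ) (ht : T ≤ t) : HasDerivAt f (Complex.exp (-μ * t) • g t) t := by
    have h1 : HasDerivAt (fun t : ℝ ↦ Complex.exp (-μ * t)) (Complex.exp (-μ * t) * (-μ)) t := by
      simpa using ((Complex.ofRealCLM.hasDerivAt (x := t)).const_mul (-μ)).cexp
    convert! h1.smul (hw t ((le_max_right _ _).trans ht)) using 1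
    module
  set B : ℝ → ℝ := fun t ↦ ‖f T‖ + ε / 2 * (Real.exp (a * t) - Real.exp (a * T)) with hB
  have hB' (t : ℝ) : HasDerivAt B (a * (ε / 2) * Real.exp (a * t)) t := by
    have h := (((hasDerivAt_id t).const_mul a).exp.sub_const (Real.exp (a * T))).const_mul (ε / 2)
    convert! h.const_add ‖f T‖ using 1
    simp only [id]
    ring
  have bound (t : ℝ) (ht : T ≤ t) : ‖f t‖ ≤ B t := by
    refine image_norm_le_of_norm_deriv_right_le_deriv_boundary (a := T) (b := t)
      (f' := fun s ↦ Complex.exp (-μ * s) • g s) ?_ ?_ ?_ hB' ?_ ⟨ht, le_rfl⟩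
    · exact fun s hs ↦ (hf' s hs.1).continuousAt.continuousWithinAt
    · exact fun s hs ↦ (hf' s hs.1).hasDerivWithinAt
    · simp [hB]
    · intro s hs
      rw [norm_smul, norm_exp, mul_comm]
      gcongr
      exact (hT₀ s ((le_max_left _ _).trans hs.1)).le
  have hdecay : Tendsto (fun t ↦ ‖f T‖ * Real.exp (-(a * t))) atTop (nhds 0) := by
    simpa using (Real.tendsto_exp_neg_atTop_nhds_zero.comp
      (tendsto_id.const_mul_atTop ha0)).const_mul ‖f T‖
  filter_upwards [hdecay.eventually_lt_const (half_pos hε), eventually_ge_atTop T] with t h1 h2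
  have h3 := bound t h2
  simp only [hf, hB, norm_smul, norm_exp] at h3 h1
  rw [Real.exp_neg, ← div_eq_mul_inv, div_lt_iff₀ (Real.exp_pos _)] at h1
  have h4 : Real.exp (a * t) * ‖w t‖ < Real.exp (a * t) * ε := by
    nlinarith [Real.exp_pos (a * T)]
  exact lt_of_mul_lt_mul_left h4 (Real.exp_pos _).le

/-- Let `w' = A w + g` with `g → 0`. If a product of factors `A - μ` with `μ.re < 0` sends `w` to a
function tending to zero, then `w` tends to zero. -/
lemma tendsto_zero_of_tendsto_aeval_prod {E : Type*} [NormedAddCommGroup E] [NormedSpace ℂ E]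
    [FiniteDimensional ℂ E] (A : Module.End ℂ E) (s : Multiset ℂ) (hs : ∀ μ ∈ s, μ.re < 0)
    {w g : ℝ → E} (hw : ∀ t, 0 ≤ t → HasDerivAt w (A (w t) + g t) t)
    (hg : Tendsto g atTop (nhds 0))
    (h : Tendsto (fun t ↦ Polynomial.aeval A
      (s.map fun μ ↦ Polynomial.X - Polynomial.C μ).prod (w t)) atTop (nhds 0)) :
    Tendsto w atTop (nhds 0) := by
  induction s using Multiset.induction_on generalizing w g with
  | empty => simpa using h
  | cons μ s ih =>
    set L : E →L[ℂ] E := LinearMap.toContinuousLinearMap (A - algebraMap ℂ (Module.End ℂ E) μ)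
    have hL (v : E) : L v = A v - μ • v := by simp [L]
    have hLg : Tendsto (fun t ↦ L (g t)) atTop (nhds 0) := by
      simpa [Function.comp_def] using (L.continuous.tendsto 0).comp hg
    have hLw : Tendsto (fun t ↦ L (w t)) atTop (nhds 0) := by
      refine ih (fun ν hν ↦ hs ν (Multiset.mem_cons_of_mem hν)) (fun t ht ↦ ?_) hLg ?_
      · convert! (L.restrictScalars ℝ).hasFDerivAt.comp_hasDerivAt t (hw t ht) using 1
        simp [hL]
        abel
      · refine h.congr fun t ↦ ?_
        rw [Multiset.map_cons, Multiset.prod_cons, mul_comm, map_mul, Module.End.mul_apply]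
        simp [hL]
    refine tendsto_zero_of_hasDerivAt_smul_add (hs μ (Multiset.mem_cons_self μ s))
      (g := fun t ↦ L (w t) + g t) (fun t ht ↦ ?_) (by simpa using hLw.add hg)
    convert! hw t ht using 1
    rw [hL]
    abel

/-- If the spectrum of `A` lies in the open left half-plane, every solution of `w' = A w + g` with
`g → 0` tends to zero. -/
lemma tendsto_zero_of_spectrum_re_neg {E : Type*} [NormedAddCommGroup E] [NormedSpace ℂ E]
    [FiniteDimensional ℂ E] (A : Module.End ℂ E) (hA : ∀ μ ∈ spectrum ℂ A, μ.re < 0)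
    {w g : ℝ → E} (hw : ∀ t, 0 ≤ t → HasDerivAt w (A (w t) + g t) t)
    (hg : Tendsto g atTop (nhds 0)) : Tendsto w atTop (nhds 0) := by
  refine tendsto_zero_of_tendsto_aeval_prod A A.charpoly.roots (fun μ hμ ↦ ?_) hw hg ?_
  · exact hA μ (Module.End.hasEigenvalue_iff_mem_spectrum.1
      (A.hasEigenvalue_iff_isRoot_charpoly μ |>.2 (Polynomial.isRoot_of_mem_roots hμ)))
  · rw [← (IsAlgClosed.splits A.charpoly).eq_prod_roots_of_monic A.charpoly_monic,
      A.aeval_self_charpoly]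
    simp

lemma IsHurwitz.isUnit_det {m : ℕ} {M : Matrix (Fin m) (Fin m) ℝ} (hM : IsHurwitz M) :
    IsUnit M.det := by
  have h : IsUnit (M.map (algebraMap ℝ ℂ)) :=
    (spectrum.zero_notMem_iff ℂ).1 fun h0 ↦ by simpa using hM 0 h0
  rw [Matrix.isUnit_iff_isUnit_det, isUnit_iff_ne_zero] at h
  refine isUnit_iff_ne_zero.2 fun h0 ↦ h ?_
  simpa [h0] using ((algebraMap ℝ ℂ).map_det M).symm

/-- Cascade lemma: a stable linear system `x' = M x + u` driven by a
convergent continuous input `u → uLim` converges to `-M⁻¹ uLim`. -/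
theorem stmt_13 (m : ℕ) (hm : 0 < m) (M : Matrix (Fin m) (Fin m) ℝ)
    (hM : IsHurwitz M)
    (u : ℝ → (Fin m → ℝ)) (hu : Continuous u)
    (uLim : Fin m → ℝ) (hulim : Tendsto u atTop (nhds uLim))
    (x : ℝ → (Fin m → ℝ)) (hx : Differentiable ℝ x)
    (hode : ∀ t : ℝ, 0 ≤ t → deriv x t = M.mulVec (x t) + u t) :
    Tendsto x atTop (nhds (-(M⁻¹.mulVec uLim))) := by
  set c := -(M⁻¹.mulVec uLim) with hc
  have hMc : M.mulVec c = -uLim := by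
    rw [hc, mulVec_neg, mulVec_mulVec, mul_nonsing_inv _ hM.isUnit_det, one_mulVec]
  have hw : Tendsto (fun t i ↦ ((x t i - c i : ℝ) : ℂ)) atTop (nhds 0) := by
    refine tendsto_zero_of_spectrum_re_neg (Matrix.toLin' (M.map (algebraMap ℝ ℂ)))
      (g := fun t i ↦ ((u t i - uLim i : ℝ) : ℂ)) (by rwa [spectrum_toLin']) (fun t ht ↦ ?_) ?_
    · rw [hasDerivAt_pi]
      intro i
      have hxi := (hasDerivAt_pi.1 (hx t).hasDerivAt i).sub_const (c i)
      convert! hxi.ofReal_comp using 1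
      have hmap := RingHom.map_mulVec (algebraMap ℝ ℂ) M (x t - c) i
      rw [mulVec_sub, hMc] at hmap
      simp only [toLin'_apply, Pi.add_apply]
      refine (congrArg (· + _) hmap.symm).trans ?_
      simp [hode t ht]
    · rw [tendsto_pi_nhds]
      intro i
      have h := (tendsto_pi_nhds.1 hulim i).sub_const (uLim i)
      rw [sub_self] at h
      exact (Complex.continuous_ofReal.tendsto' 0 0 Complex.ofReal_zero).comp h
  rw [tendsto_pi_nhds] at hw ⊢
  intro i
  have h := (Complex.continuous_re.tendsto 0).comp (hw i)
  simpa using h.add_const (c i)
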